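/- arXiv:2210.11393 — 2 statements merged into one kernel-verified Lean document; each statement's English description precedes it below -/
import Mathlib

section
/- Fix integers d ≥ 2 and r ≥ 1, a differentiable pure-state family ψ at θ₀ on ℂ^d with 𝔫 > 0, and a POVM M on ℂ^d with r outcomes; set ψ₀⊥ = (1/√𝔫)(1 − ψ₀ψ₀*)ψ₀'. For x ∈ ℝ^r set X = Σᵢ xᵢMᵢ and X₂ = Σᵢ xᵢ²Mᵢ. Call a pair (x, U), with x ∈ ℝ^r and U a d×d unitary matrix, feasible if Re Tr(Uρ₀U*X) = 0 and Re Tr(Uρ₀'U*X) = 1. Suppose a feasible pair (x, U) minimizes Re Tr(Uρ₀U*X₂) over all feasible pairs. Then, with φ = Uψ₀ and φ⊥ = Uψ₀⊥: (1) Xφ = (1/(2√𝔫))·φ⊥; and (2) (⟨φ, X₂φ⟩·X² − ⟨φ, X²φ⟩·X₂)φ = 0. -/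
open scoped Matrix Kronecker ComplexOrder
open Classical

noncomputable section

/-- A density matrix: positive semidefinite with unit trace. -/
def IsDensityMatrix {n : Type*} [Fintype n] (ρ : Matrix n n ℂ) : Prop :=
  ρ.PosSemidef ∧ ρ.trace = 1

/-- A POVM with `r` outcomes. -/
def IsPOVM {n : Type*} [Fintype n] [DecidableEq n] {r : ℕ}
    (M : Fin r → Matrix n n ℂ) : Prop :=
  (∀ i, (M i).PosSemidef) ∧ ∑ i, M i = 1

/-- The Fisher information of the measurement-outcome distribution. -/
def FisherInfo {n : Type*} [Fintype n] {r : ℕ}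
    (ρ ρ' : Matrix n n ℂ) (M : Fin r → Matrix n n ℂ) : ℝ :=
  ∑ i, if (ρ * M i).trace = 0 then 0
    else ((ρ' * M i).trace.re) ^ 2 / ((ρ * M i).trace.re)

/-- A quantum channel (CPTP map) given by finitely many Kraus operators. -/
def IsQuantumChannel {m n : Type*} [Fintype m] [Fintype n] [DecidableEq m]
    (E : Matrix m m ℂ → Matrix n n ℂ) : Prop :=
  ∃ (κ : ℕ) (K : Fin κ → Matrix n m ℂ),
    (∑ j, (K j)ᴴ * K j = 1) ∧ ∀ σ, E σ = ∑ j, K j * σ * (K j)ᴴ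

/-- Quantum preprocessing-optimized Fisher information. -/
def QPFI {m n : Type*} [Fintype m] [Fintype n] [DecidableEq m] {r : ℕ}
    (ρ ρ' : Matrix m m ℂ) (M : Fin r → Matrix n n ℂ) : ℝ :=
  sSup {x : ℝ | ∃ E : Matrix m m ℂ → Matrix n n ℂ,
    IsQuantumChannel E ∧ x = FisherInfo (E ρ) (E ρ') M}

/-- Quantum unitary-preprocessing-optimized Fisher information. -/
def QUPFI {n : Type*} [Fintype n] [DecidableEq n] {r : ℕ}
    (ρ ρ' : Matrix n n ℂ) (M : Fin r → Matrix n n ℂ) : ℝ :=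
  sSup {x : ℝ | ∃ U : Matrix n n ℂ, U ∈ Matrix.unitaryGroup n ℂ ∧
    x = FisherInfo (U * ρ * Uᴴ) (U * ρ' * Uᴴ) M}

/-- Complex inner product, conjugate-linear in the first argument. -/
def cInner {n : Type*} [Fintype n] (φ ψ : n → ℂ) : ℂ := ∑ k, star (φ k) * ψ k

/-- The functional whose supremum over orthonormal pairs is the normalized QPFI. -/
def gammaSummand {n : Type*} [Fintype n] {r : ℕ}
    (M : Fin r → Matrix n n ℂ) (φ φp : n → ℂ) : ℝ :=
  ∑ i, if cInner φ (M i *ᵥ φ) = 0 then 0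
    else ((cInner φ (M i *ᵥ φp)).re) ^ 2 / ((cInner φ (M i *ᵥ φ)).re)

/-- The normalized QPFI of a POVM. -/
def gammaPOVM {n : Type*} [Fintype n] {r : ℕ} (M : Fin r → Matrix n n ℂ) : ℝ :=
  sSup {x : ℝ | ∃ φ φp : n → ℂ,
    cInner φ φ = 1 ∧ cInner φp φp = 1 ∧ cInner φ φp = 0 ∧ x = gammaSummand M φ φp}

/-- Quantum Fisher information: the Fisher information optimized over all POVMs. -/
def QFI {m : Type*} [Fintype m] [DecidableEq m] (ρ ρ' : Matrix m m ℂ) : ℝ :=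
  sSup {x : ℝ | ∃ (κ : ℕ) (T : Fin κ → Matrix m m ℂ), IsPOVM T ∧ x = FisherInfo ρ ρ' T}

/-- Classical Fisher information of a finite probability distribution. -/
def classFisher {r : ℕ} (p p' : Fin r → ℝ) : ℝ :=
  ∑ i, if p i = 0 then 0 else (p' i) ^ 2 / p i

section helpers

variable {n : Type*} [Fintype n]

lemma ci_eq (u v : n → ℂ) : cInner u v = star u ⬝ᵥ v := rfl

lemma ci_add_left (u v w : n → ℂ) : cInner (u + v) w = cInner u w + cInner v w := by
  simp [ci_eq, add_dotProduct]

lemma ci_add_right (u v w : n → ℂ) : cInner u (v + w) = cInner u v + cInner u w := by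
  simp [ci_eq, dotProduct_add]

lemma ci_sub_left (u v w : n → ℂ) : cInner (u - v) w = cInner u w - cInner v w := by
  simp [ci_eq, sub_dotProduct]

lemma ci_sub_right (u v w : n → ℂ) : cInner u (v - w) = cInner u v - cInner u w := by
  simp [ci_eq, dotProduct_sub]

lemma ci_smul_left (c : ℂ) (u v : n → ℂ) : cInner (c • u) v = star c * cInner u v := by
  simp [ci_eq]

lemma ci_smul_right (c : ℂ) (u v : n → ℂ) : cInner u (c • v) = c * cInner u v := by
  simp [ci_eq]

lemma ci_conj (u v : n → ℂ) : star (cInner u v) = cInner v u := by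
  simp [cInner, mul_comm]

lemma ci_adj (A : Matrix n n ℂ) (u v : n → ℂ) : cInner u (A *ᵥ v) = cInner (Aᴴ *ᵥ u) v := by
  rw [ci_eq, ci_eq, Matrix.star_mulVec, Matrix.conjTranspose_conjTranspose,
    Matrix.dotProduct_mulVec]

lemma ci_herm {A : Matrix n n ℂ} (hA : A.IsHermitian) (u v : n → ℂ) :
    cInner u (A *ᵥ v) = cInner (A *ᵥ u) v := by
  rw [ci_adj, hA.eq]

lemma ci_re_symm (u v : n → ℂ) : (cInner u v).re = (cInner v u).re := by
  rw [← ci_conj u v]; simp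

lemma ci_self_im (u : n → ℂ) : (cInner u u).im = 0 := by
  have := congrArg Complex.im (ci_conj u u)
  simp at this; linarith

lemma ci_self_real (u : n → ℂ) : cInner u u = ((cInner u u).re : ℂ) := by
  apply Complex.ext <;> simp [ci_self_im]

lemma ci_herm_real {A : Matrix n n ℂ} (hA : A.IsHermitian) (u : n → ℂ) :
    cInner u (A *ᵥ u) = ((cInner u (A *ᵥ u)).re : ℂ) := by
  have := congrArg Complex.im (ci_conj u (A *ᵥ u))
  rw [← ci_herm hA] at this
  simp at this
  apply Complex.ext
  · simp
  · simp; linarith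

lemma ci_self_nonneg (u : n → ℂ) : 0 ≤ (cInner u u).re := by
  simp only [cInner, Complex.re_sum]
  apply Finset.sum_nonneg
  intro i _
  simp
  nlinarith [sq_nonneg (u i).re, sq_nonneg (u i).im]

lemma ci_self_zero {u : n → ℂ} (h : (cInner u u).re ≤ 0) : u = 0 := by
  have h1 : cInner u u = 0 := by
    rw [ci_self_real, le_antisymm h (ci_self_nonneg u)]; simp
  rw [ci_eq] at h1
  exact dotProduct_star_self_eq_zero.mp h1

lemma tr_vec (V X : Matrix n n ℂ) (a b : n → ℂ) :
    (V * Matrix.vecMulVec a (star b) * Vᴴ * X).trace = cInner (V *ᵥ b) (X *ᵥ (V *ᵥ a)) := by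
  rw [Matrix.mul_vecMulVec, Matrix.vecMulVec_mul, Matrix.vecMulVec_mul, Matrix.trace_vecMulVec,
    ci_eq, Matrix.star_mulVec, dotProduct_comm, Matrix.dotProduct_mulVec (_ ᵥ* Vᴴ) X]

end helpers

lemma exists_cols {d : ℕ} (hd : 2 ≤ d) (u v : Fin d → ℂ) (hu : cInner u u = 1)
    (hv : cInner v v = 1) (huv : cInner u v = 0) :
    ∃ A ∈ Matrix.unitaryGroup (Fin d) ℂ, A *ᵥ (Pi.single ⟨0, by omega⟩ 1) = u ∧
      A *ᵥ (Pi.single ⟨1, by omega⟩ 1) = v := by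
  let z : Fin d := ⟨0, by omega⟩
  let o : Fin d := ⟨1, by omega⟩
  have hzo : z ≠ o := by simp [z, o]
  let f : Fin d → EuclideanSpace ℂ (Fin d) :=
    fun i => if i = z then WithLp.toLp 2 u else WithLp.toLp 2 v
  have hin : ∀ a b : Fin d → ℂ, inner ℂ (WithLp.toLp 2 a) (WithLp.toLp 2 b) = cInner a b := by
    intro a b
    simp [cInner, PiLp.inner_apply, mul_comm]
  have hvu : cInner v u = 0 := by rw [← ci_conj, huv]; simp
  have hf : Orthonormal ℂ (({z, o} : Set (Fin d)).domRestrict f) := by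
    rw [orthonormal_iff_ite]
    rintro ⟨i, hi⟩ ⟨j, hj⟩
    simp only [Set.mem_insert_iff, Set.mem_singleton_iff] at hi hj
    rcases hi with rfl | rfl <;> rcases hj with rfl | rfl <;>
      simp [-inner_self_eq_norm_sq_to_K, f, hin, hu, hv, huv, hvu, hzo, hzo.symm, Set.domRestrict]
  obtain ⟨b, hb⟩ := hf.exists_orthonormalBasis_extension_of_card_eq (by simp)
  refine ⟨Matrix.of fun i j => b j i, ?_, ?_, ?_⟩
  · rw [Matrix.mem_unitaryGroup_iff']
    ext i j
    have := orthonormal_iff_ite.mp b.orthonormal i j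
    rw [Matrix.one_apply, ← this]
    simp [Matrix.mul_apply, PiLp.inner_apply, mul_comm, Matrix.star_apply]
  · have := hb z (by simp)
    ext i
    have h2 := congrFun (congrArg WithLp.ofLp this) i
    simpa [f] using h2
  · have := hb o (by simp)
    ext i
    have h2 := congrFun (congrArg WithLp.ofLp this) i
    simpa [f, hzo.symm] using h2

lemma exists_unitary {d : ℕ} (hd : 2 ≤ d) (u v u' v' : Fin d → ℂ) (hu : cInner u u = 1)
    (hv : cInner v v = 1) (huv : cInner u v = 0) (hu' : cInner u' u' = 1)
    (hv' : cInner v' v' = 1) (huv' : cInner u' v' = 0) :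
    ∃ A ∈ Matrix.unitaryGroup (Fin d) ℂ, A *ᵥ u = u' ∧ A *ᵥ v = v' := by
  obtain ⟨A, hA, hA1, hA2⟩ := exists_cols hd u v hu hv huv
  obtain ⟨B, hB, hB1, hB2⟩ := exists_cols hd u' v' hu' hv' huv'
  have hAA : star A * A = 1 := Matrix.mem_unitaryGroup_iff'.mp hA
  refine ⟨B * star A, mul_mem hB (Unitary.star_mem hA), ?_, ?_⟩
  · rw [← hA1, Matrix.mulVec_mulVec, mul_assoc, hAA, mul_one, hB1]
  · rw [← hA2, Matrix.mulVec_mulVec, mul_assoc, hAA, mul_one, hB2]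

lemma poly_min {a b n1 n2 p1 p2 q1 q2 m1 m2 : ℝ}
    (h : ∀ t : ℝ, a * ((1 + n1 * t + n2 * t^2)^2 * (b + q1 * t + q2 * t^2)
        - (1 + n1 * t + n2 * t^2) * (m1 * t + m2 * t^2)^2)
      ≤ b * ((1 + n1 * t + n2 * t^2)^2 * (a + p1 * t + p2 * t^2)
        - (1 + n1 * t + n2 * t^2) * (m1 * t + m2 * t^2)^2)) : b * p1 = a * q1 := by
  have hN : HasDerivAt (fun t : ℝ => 1 + n1 * t + n2 * t^2) n1 0 := by
    have := (((hasDerivAt_id' (0:ℝ)).const_mul n1).const_add 1).fun_add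
      (((hasDerivAt_id' (0:ℝ)).fun_pow 2).const_mul n2)
    exact this.congr_deriv (by simp)
  have hQ : HasDerivAt (fun t : ℝ => b + q1 * t + q2 * t^2) q1 0 := by
    have := (((hasDerivAt_id' (0:ℝ)).const_mul q1).const_add b).fun_add
      (((hasDerivAt_id' (0:ℝ)).fun_pow 2).const_mul q2)
    exact this.congr_deriv (by simp)
  have hP : HasDerivAt (fun t : ℝ => a + p1 * t + p2 * t^2) p1 0 := by
    have := (((hasDerivAt_id' (0:ℝ)).const_mul p1).const_add a).fun_add
      (((hasDerivAt_id' (0:ℝ)).fun_pow 2).const_mul p2)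
    exact this.congr_deriv (by simp)
  have hm : HasDerivAt (fun t : ℝ => m1 * t + m2 * t^2) m1 0 := by
    have := (((hasDerivAt_id' (0:ℝ)).const_mul m1)).fun_add
      (((hasDerivAt_id' (0:ℝ)).fun_pow 2).const_mul m2)
    exact this.congr_deriv (by simp)
  have hg := (((((hN.fun_pow 2).fun_mul hP).fun_sub (hN.fun_mul (hm.fun_pow 2))).const_mul b)).fun_sub
    (((((hN.fun_pow 2).fun_mul hQ).fun_sub (hN.fun_mul (hm.fun_pow 2))).const_mul a))
  have hmin : IsLocalMin (fun t : ℝ => b * ((1 + n1 * t + n2 * t^2)^2 * (a + p1 * t + p2 * t^2)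
        - (1 + n1 * t + n2 * t^2) * (m1 * t + m2 * t^2)^2) -
      a * ((1 + n1 * t + n2 * t^2)^2 * (b + q1 * t + q2 * t^2)
        - (1 + n1 * t + n2 * t^2) * (m1 * t + m2 * t^2)^2)) 0 := by
    apply Filter.Eventually.of_forall
    intro t
    have := h t
    simp only []
    nlinarith
  have := hmin.hasDerivAt_eq_zero hg
  norm_num at this
  linarith


section povm

variable {d r : ℕ}

lemma povm_herm {M : Fin r → Matrix (Fin d) (Fin d) ℂ} (hM : IsPOVM M) (y : Fin r → ℝ) :
    (∑ i, (y i : ℂ) • M i).IsHermitian := by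
  unfold Matrix.IsHermitian
  rw [Matrix.conjTranspose_sum]
  refine Finset.sum_congr rfl fun i _ => ?_
  rw [Matrix.conjTranspose_smul, (hM.1 i).1.eq]
  simp

lemma povm_ci (M : Fin r → Matrix (Fin d) (Fin d) ℂ) (y : Fin r → ℂ) (u w : Fin d → ℂ) :
    cInner u ((∑ i, y i • M i) *ᵥ w) = ∑ i, y i * cInner u (M i *ᵥ w) := by
  rw [Matrix.sum_mulVec, ci_eq, dotProduct_sum]
  refine Finset.sum_congr rfl fun i _ => ?_
  rw [Matrix.smul_mulVec, dotProduct_smul, ci_eq, smul_eq_mul]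

lemma psd_nonneg {A : Matrix (Fin d) (Fin d) ℂ} (hA : A.PosSemidef) (w : Fin d → ℂ) :
    0 ≤ (cInner w (A *ᵥ w)).re := by
  have := hA.dotProduct_mulVec_nonneg w
  exact (Complex.le_def.mp this).1

lemma povm_sq_re (M : Fin r → Matrix (Fin d) (Fin d) ℂ) (y : Fin r → ℝ) (w : Fin d → ℂ) :
    (cInner w ((∑ i, (y i : ℂ) ^ 2 • M i) *ᵥ w)).re
      = ∑ i, y i ^ 2 * (cInner w (M i *ᵥ w)).re := by
  rw [povm_ci, Complex.re_sum]
  refine Finset.sum_congr rfl fun i _ => ?_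
  rw [← Complex.ofReal_pow, Complex.re_ofReal_mul]

lemma povm_sq_nonneg {M : Fin r → Matrix (Fin d) (Fin d) ℂ} (hM : IsPOVM M) (y : Fin r → ℝ)
    (w : Fin d → ℂ) : 0 ≤ (cInner w ((∑ i, (y i : ℂ) ^ 2 • M i) *ᵥ w)).re := by
  rw [povm_sq_re]
  exact Finset.sum_nonneg fun i _ => mul_nonneg (sq_nonneg _) (psd_nonneg (hM.1 i) w)

lemma povm_sq_zero {M : Fin r → Matrix (Fin d) (Fin d) ℂ} (hM : IsPOVM M) (y : Fin r → ℝ)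
    (w : Fin d → ℂ) (h : (cInner w ((∑ i, (y i : ℂ) ^ 2 • M i) *ᵥ w)).re = 0) :
    (∑ i, (y i : ℂ) • M i) *ᵥ w = 0 := by
  rw [povm_sq_re, Finset.sum_eq_zero_iff_of_nonneg
    (fun i _ => mul_nonneg (sq_nonneg _) (psd_nonneg (hM.1 i) w))] at h
  rw [Matrix.sum_mulVec]
  refine Finset.sum_eq_zero fun i hi => ?_
  rw [Matrix.smul_mulVec]
  rcases mul_eq_zero.mp (h i hi) with h1 | h1
  · have : y i = 0 := by simpa using h1
    simp [this]
  · have h2 : star w ⬝ᵥ (M i *ᵥ w) = 0 := by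
      rw [← ci_eq, ci_herm_real (hM.1 i).1, h1]; simp
    rw [((hM.1 i).dotProduct_mulVec_zero_iff w).mp h2, smul_zero]

/-- Matrix elements of the affinely transformed observable. -/
lemma povm_affine {M : Fin r → Matrix (Fin d) (Fin d) ℂ} (hM : IsPOVM M) (x : Fin r → ℝ)
    (N m : ℝ) : (∑ i, ((N * x i - m : ℝ) : ℂ) • M i)
      = (N : ℂ) • (∑ i, (x i : ℂ) • M i) - (m : ℂ) • 1 := by
  rw [← hM.2, Finset.smul_sum, Finset.smul_sum, ← Finset.sum_sub_distrib]
  refine Finset.sum_congr rfl fun i _ => ?_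
  rw [smul_smul, ← sub_smul]; push_cast; rfl

lemma povm_affine_sq {M : Fin r → Matrix (Fin d) (Fin d) ℂ} (hM : IsPOVM M) (x : Fin r → ℝ)
    (N m : ℝ) : (∑ i, ((N * x i - m : ℝ) : ℂ) ^ 2 • M i)
      = ((N ^ 2 : ℝ) : ℂ) • (∑ i, (x i : ℂ) ^ 2 • M i)
        - ((2 * N * m : ℝ) : ℂ) • (∑ i, (x i : ℂ) • M i) + ((m ^ 2 : ℝ) : ℂ) • 1 := by
  rw [← hM.2, Finset.smul_sum, Finset.smul_sum, Finset.smul_sum, ← Finset.sum_sub_distrib,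
    ← Finset.sum_add_distrib]
  refine Finset.sum_congr rfl fun i _ => ?_
  rw [smul_smul, smul_smul, ← sub_smul, ← add_smul]; push_cast; congr 1; ring

/-- Homogeneous inequality implied by minimality. -/
lemma key_ineq (hd : 2 ≤ d) {M : Fin r → Matrix (Fin d) (Fin d) ℂ} (hM : IsPOVM M)
    (ψ₀ ψp : Fin d → ℂ) (h0 : cInner ψ₀ ψ₀ = 1) (hp : cInner ψp ψp = 1)
    (h0p : cInner ψ₀ ψp = 0) (a s : ℝ) (hs : 0 < s)
    (hmin : ∀ (y : Fin r → ℝ) (V : Matrix (Fin d) (Fin d) ℂ),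
      V ∈ Matrix.unitaryGroup (Fin d) ℂ →
      (cInner (V *ᵥ ψ₀) ((∑ i, (y i : ℂ) • M i) *ᵥ (V *ᵥ ψ₀))).re = 0 →
      2 * s * (cInner (V *ᵥ ψp) ((∑ i, (y i : ℂ) • M i) *ᵥ (V *ᵥ ψ₀))).re = 1 →
      a ≤ (cInner (V *ᵥ ψ₀) ((∑ i, (y i : ℂ) ^ 2 • M i) *ᵥ (V *ᵥ ψ₀))).re)
    (y : Fin r → ℝ) (w : Fin d → ℂ) (Y : Matrix (Fin d) (Fin d) ℂ)
    (hY : Y = ∑ i, (y i : ℂ) • M i)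
    (hw : (cInner w (Y *ᵥ w)).re = 0) :
    a * (cInner (Y *ᵥ w) (Y *ᵥ w)).re
      ≤ (2 * s)⁻¹ ^ 2 * (cInner w ((∑ i, (y i : ℂ) ^ 2 • M i) *ᵥ w)).re := by
  have hYh : Y.IsHermitian := hY ▸ povm_herm hM y
  by_cases hv : Y *ᵥ w = 0
  · rw [hv]
    have := povm_sq_nonneg hM y w
    have h2 : cInner (0 : Fin d → ℂ) 0 = 0 := by simp [cInner]
    rw [h2]; simp only [Complex.zero_re, mul_zero]; positivity
  have hw0 : w ≠ 0 := by rintro rfl; simp at hv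
  set v := Y *ᵥ w with hvdef
  have hN : 0 < (cInner w w).re := by
    by_contra h; exact hw0 (ci_self_zero (not_lt.mp h))
  have hq : 0 < (cInner v v).re := by
    by_contra h; exact hv (ci_self_zero (not_lt.mp h))
  have hwN := ci_self_real w
  have hvq := ci_self_real v
  have hwv : cInner w v = 0 := by
    rw [hvdef, ci_herm_real hYh, hw]; simp
  set N := (cInner w w).re
  set q := (cInner v v).re
  obtain ⟨α, hα, hαN⟩ : ∃ α : ℝ, 0 < α ∧ α ^ 2 = N := ⟨√N, Real.sqrt_pos.mpr hN, Real.sq_sqrt hN.le⟩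
  obtain ⟨β, hβ, hβq⟩ : ∃ β : ℝ, 0 < β ∧ β ^ 2 = q := ⟨√q, Real.sqrt_pos.mpr hq, Real.sq_sqrt hq.le⟩
  have hαc : (α : ℂ) ≠ 0 := by exact_mod_cast hα.ne'
  have hβc : (β : ℂ) ≠ 0 := by exact_mod_cast hβ.ne'
  obtain ⟨V, hV, hV1, hV2⟩ := exists_unitary hd ψ₀ ψp (((α⁻¹ : ℝ) : ℂ) • w) (((β⁻¹ : ℝ) : ℂ) • v)
    h0 hp h0p
    (by rw [ci_smul_left, ci_smul_right, hwN, ← hαN]; simp; field_simp)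
    (by rw [ci_smul_left, ci_smul_right, hvq, ← hβq]; simp; field_simp)
    (by rw [ci_smul_left, ci_smul_right, hwv]; simp)
  set k : ℝ := (2 * s)⁻¹ * α / β with hk
  have hY1 : (∑ i, ((k * y i : ℝ) : ℂ) • M i) = (k : ℂ) • Y := by
    rw [hY, Finset.smul_sum]
    refine Finset.sum_congr rfl fun i _ => ?_
    rw [smul_smul]; push_cast; rfl
  have hY2 : (∑ i, ((k * y i : ℝ) : ℂ) ^ 2 • M i)
      = ((k ^ 2 : ℝ) : ℂ) • (∑ i, (y i : ℂ) ^ 2 • M i) := by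
    rw [Finset.smul_sum]
    refine Finset.sum_congr rfl fun i _ => ?_
    rw [smul_smul]; push_cast; congr 1; ring
  have := hmin (fun i => k * y i) V hV
  rw [hY1, hY2, hV1, hV2] at this
  simp only [Matrix.smul_mulVec, Matrix.mulVec_smul, ci_smul_left, ci_smul_right, ← hvdef, hwv,
    hvq, ← hβq, Complex.star_def, Complex.conj_ofReal, Complex.re_ofReal_mul, Complex.ofReal_re,
    mul_zero, Complex.zero_re] at this
  have h3 := this trivial (by rw [hk]; field_simp)
  rw [← hβq]
  calc a * β ^ 2 ≤ _ := mul_le_mul_of_nonneg_right h3 (sq_nonneg β)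
    _ = _ := by rw [hk]; field_simp

end povm

/-- necessary conditions satisfied by an optimal pair `(x, U)` of error vector
and preprocessing unitary for a pure-state family: `Xφ = (1/(2√𝔫))·φ⊥` and
`(⟨φ,X₂φ⟩·X² − ⟨φ,X²φ⟩·X₂)φ = 0`. -/
theorem stmt4 {d r : ℕ} (hd : 2 ≤ d) (hr : 1 ≤ r)
    (ψ : ℝ → Fin d → ℂ) (ψ' : Fin d → ℂ) (θ₀ : ℝ)
    (hnorm : ∀ θ, cInner (ψ θ) (ψ θ) = 1)
    (hder : ∀ k, HasDerivAt (fun θ => ψ θ k) (ψ' k) θ₀)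
    (ρ₀ ρ₀' : Matrix (Fin d) (Fin d) ℂ)
    (hρ₀ : ρ₀ = Matrix.vecMulVec (ψ θ₀) (star (ψ θ₀)))
    (hρ₀' : ρ₀' = Matrix.vecMulVec ψ' (star (ψ θ₀)) + Matrix.vecMulVec (ψ θ₀) (star ψ'))
    (nf : ℝ) (hnf : nf = (cInner ψ' (ψ' - cInner (ψ θ₀) ψ' • ψ θ₀)).re) (hnfpos : 0 < nf)
    (ψperp : Fin d → ℂ)
    (hψperp : ψperp = ((Real.sqrt nf : ℝ) : ℂ)⁻¹ • (ψ' - cInner (ψ θ₀) ψ' • ψ θ₀))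
    (M : Fin r → Matrix (Fin d) (Fin d) ℂ) (hM : IsPOVM M)
    (x : Fin r → ℝ) (U : Matrix (Fin d) (Fin d) ℂ)
    (hU : U ∈ Matrix.unitaryGroup (Fin d) ℂ)
    (X X₂ : Matrix (Fin d) (Fin d) ℂ)
    (hX : X = ∑ i, (x i : ℂ) • M i) (hX₂ : X₂ = ∑ i, ((x i : ℂ)) ^ 2 • M i)
    (hfeas₁ : (U * ρ₀ * Uᴴ * X).trace.re = 0)
    (hfeas₂ : (U * ρ₀' * Uᴴ * X).trace.re = 1)
    (hmin : ∀ (y : Fin r → ℝ) (V : Matrix (Fin d) (Fin d) ℂ),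
      V ∈ Matrix.unitaryGroup (Fin d) ℂ →
      (V * ρ₀ * Vᴴ * ∑ i, (y i : ℂ) • M i).trace.re = 0 →
      (V * ρ₀' * Vᴴ * ∑ i, (y i : ℂ) • M i).trace.re = 1 →
      (U * ρ₀ * Uᴴ * X₂).trace.re ≤ (V * ρ₀ * Vᴴ * ∑ i, ((y i : ℂ)) ^ 2 • M i).trace.re) :
    X *ᵥ (U *ᵥ ψ θ₀) = (((2 * Real.sqrt nf : ℝ) : ℂ))⁻¹ • (U *ᵥ ψperp)
    ∧ ((cInner (U *ᵥ ψ θ₀) (X₂ *ᵥ (U *ᵥ ψ θ₀))) • (X * X)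
        - (cInner (U *ᵥ ψ θ₀) ((X * X) *ᵥ (U *ᵥ ψ θ₀))) • X₂) *ᵥ (U *ᵥ ψ θ₀) = 0 := by
  clear hr
  have h0 : cInner (ψ θ₀) (ψ θ₀) = 1 := hnorm θ₀
  set α := cInner (ψ θ₀) ψ' with hα
  have hαre : α.re = 0 := by
    have h1 : HasDerivAt (fun θ => cInner (ψ θ) (ψ θ))
        (∑ k, (star (ψ' k) * ψ θ₀ k + star (ψ θ₀ k) * ψ' k)) θ₀ := by
      unfold cInner
      exact HasDerivAt.fun_sum fun k _ => (hder k).star.mul (hder k)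
    have h2 : (fun θ => cInner (ψ θ) (ψ θ)) = fun _ => (1 : ℂ) := funext hnorm
    rw [h2] at h1
    have h3 := h1.unique (hasDerivAt_const θ₀ (1 : ℂ))
    rw [Finset.sum_add_distrib] at h3
    change cInner ψ' (ψ θ₀) + cInner (ψ θ₀) ψ' = 0 at h3
    have h4 := congrArg Complex.re h3
    rw [Complex.add_re, ci_re_symm ψ', ← hα, Complex.zero_re] at h4
    linarith
  set s := √nf with hs
  have hspos : 0 < s := Real.sqrt_pos.mpr hnfpos
  have hs2 : s ^ 2 = nf := Real.sq_sqrt hnfpos.le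
  have hsc : (s : ℂ) ≠ 0 := by exact_mod_cast hspos.ne'
  set g := ψ' - α • ψ θ₀ with hg
  have h0g : cInner (ψ θ₀) g = 0 := by
    rw [hg, ci_sub_right, ci_smul_right, h0, ← hα]; ring
  have hgg : cInner g g = (nf : ℂ) := by
    rw [ci_self_real]
    congr 1
    rw [hnf]
    conv_lhs => rw [hg, ci_sub_left, ← hg, ci_smul_left, h0g]
    simp
  have h0p : cInner (ψ θ₀) ψperp = 0 := by
    rw [hψperp, ci_smul_right, h0g, mul_zero]
  have hpp : cInner ψperp ψperp = 1 := by
    rw [hψperp, ci_smul_right, ci_smul_left, hgg, ← hs2]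
    simp; field_simp
  have hψ' : ψ' = (s : ℂ) • ψperp + α • ψ θ₀ := by
    rw [hψperp, smul_smul, mul_inv_cancel₀ hsc, one_smul, hg]; simp
  have tr1 : ∀ V A : Matrix (Fin d) (Fin d) ℂ,
      (V * ρ₀ * Vᴴ * A).trace.re = (cInner (V *ᵥ ψ θ₀) (A *ᵥ (V *ᵥ ψ θ₀))).re := by
    intro V A
    rw [hρ₀, tr_vec]
  have tr2 : ∀ V A : Matrix (Fin d) (Fin d) ℂ, A.IsHermitian →
      (V * ρ₀' * Vᴴ * A).trace.re
        = 2 * s * (cInner (V *ᵥ ψperp) (A *ᵥ (V *ᵥ ψ θ₀))).re := by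
    intro V A hA
    rw [hρ₀', Matrix.mul_add, Matrix.add_mul, Matrix.add_mul, Matrix.trace_add, tr_vec, tr_vec,
      Complex.add_re, ci_herm hA, ci_re_symm (A *ᵥ (V *ᵥ ψ θ₀))]
    have : (cInner (V *ᵥ ψ') (A *ᵥ (V *ᵥ ψ θ₀))).re
        = s * (cInner (V *ᵥ ψperp) (A *ᵥ (V *ᵥ ψ θ₀))).re := by
      rw [hψ', Matrix.mulVec_add, Matrix.mulVec_smul, Matrix.mulVec_smul, ci_add_left,
        ci_smul_left, ci_smul_left, ci_herm_real hA (V *ᵥ ψ θ₀)]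
      simp [hαre]
    rw [this]; ring
  have hXh : X.IsHermitian := hX ▸ povm_herm hM x
  have hX₂h : X₂.IsHermitian := by
    have := povm_herm hM (fun i => x i ^ 2)
    rw [hX₂]; simpa using this
  rw [tr1] at hfeas₁
  rw [tr2 _ _ hXh] at hfeas₂
  rw [tr1] at hmin
  have hUU : Uᴴ * U = 1 := Matrix.mem_unitaryGroup_iff'.mp hU
  have hUin : ∀ u v, cInner (U *ᵥ u) (U *ᵥ v) = cInner u v := by
    intro u v
    rw [ci_adj, Matrix.mulVec_mulVec, hUU, Matrix.one_mulVec]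
  have hφ : cInner (U *ᵥ ψ θ₀) (U *ᵥ ψ θ₀) = 1 := by rw [hUin, h0]
  have hφp : cInner (U *ᵥ ψperp) (U *ᵥ ψperp) = 1 := by rw [hUin, hpp]
  set φ := U *ᵥ ψ θ₀
  set φp := U *ᵥ ψperp
  set a := (cInner φ (X₂ *ᵥ φ)).re with ha
  have key := key_ineq hd hM (ψ θ₀) ψperp h0 hpp h0p a s hspos (by
    intro y V hV h1 h2
    have := hmin y V hV (by rw [tr1, h1]) (by rw [tr2 _ _ (povm_herm hM y), h2])
    rwa [tr1] at this)
  have hapos : 0 < a := by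
    rcases (hX₂ ▸ povm_sq_nonneg hM x φ : 0 ≤ (cInner φ (X₂ *ᵥ φ)).re).lt_or_eq with h | h
    · exact h
    · exfalso
      have h1 := povm_sq_zero hM x φ (by rw [← hX₂, ← h])
      rw [← hX] at h1
      rw [h1] at hfeas₂
      simp [cInner] at hfeas₂
  have part1 : X *ᵥ φ = (((2 * s : ℝ) : ℂ))⁻¹ • φp := by
    have h1 := key x φ X hX hfeas₁
    rw [← hX₂, ← ha] at h1
    have h2 : (cInner (X *ᵥ φ) (X *ᵥ φ)).re ≤ (2 * s)⁻¹ ^ 2 := by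
      rw [mul_comm] at h1
      exact le_of_mul_le_mul_right h1 hapos
    rw [← sub_eq_zero]
    apply ci_self_zero
    rw [← Complex.ofReal_inv, ci_sub_left, ci_sub_right, ci_sub_right, ci_smul_left, ci_smul_left,
      ci_smul_right, ci_smul_right, hφp]
    simp only [Complex.sub_re, Complex.star_def, Complex.conj_ofReal, Complex.re_ofReal_mul,
      Complex.one_re]
    rw [ci_re_symm (X *ᵥ φ) φp]
    have h3 : (cInner φp (X *ᵥ φ)).re = (2 * s)⁻¹ := by
      field_simp; linarith
    rw [h3]
    nlinarith
  refine ⟨part1, ?_⟩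
  set b := (cInner (X *ᵥ φ) (X *ᵥ φ)).re with hb
  have hbs : b = (2 * s)⁻¹ ^ 2 := by
    rw [hb, part1, ← Complex.ofReal_inv, ci_smul_left, ci_smul_right, hφp]
    simp only [Complex.star_def, Complex.conj_ofReal, Complex.re_ofReal_mul,
      Complex.one_re]
    ring
  rw [← hbs] at key
  -- homogeneous inequality for every vector
  have key2 : ∀ w : Fin d → ℂ,
      a * ((cInner w w).re ^ 2 * (cInner (X *ᵥ w) (X *ᵥ w)).re
        - (cInner w w).re * (cInner w (X *ᵥ w)).re ^ 2)
      ≤ b * ((cInner w w).re ^ 2 * (cInner w (X₂ *ᵥ w)).re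
        - (cInner w w).re * (cInner w (X *ᵥ w)).re ^ 2) := by
    intro w
    set N := (cInner w w).re with hN
    set m := (cInner w (X *ᵥ w)).re with hm
    have hmm : (cInner (X *ᵥ w) w).re = m := by rw [hm, ci_re_symm]
    have h1 := key (fun i => N * x i - m) w _ rfl
    rw [povm_affine hM, povm_affine_sq hM, ← hX, ← hX₂] at h1
    simp only [Matrix.sub_mulVec, Matrix.add_mulVec, Matrix.smul_mulVec, Matrix.one_mulVec,
      ci_sub_left, ci_sub_right, ci_add_left, ci_add_right,
      ci_smul_left, ci_smul_right, Complex.star_def, Complex.conj_ofReal, Complex.re_ofReal_mul,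
      Complex.sub_re, Complex.add_re, ← hN, ← hm, hmm] at h1
    have h2 := h1 (by ring)
    nlinarith
  -- first-order condition
  have key3 : ∀ η : Fin d → ℂ,
      b * (2 * (cInner η (X₂ *ᵥ φ)).re) = a * (2 * (cInner η ((X * X) *ᵥ φ)).re) := by
    intro η
    apply poly_min (n1 := 2 * (cInner η φ).re) (n2 := (cInner η η).re)
      (p2 := (cInner η (X₂ *ᵥ η)).re) (q2 := (cInner (X *ᵥ η) (X *ᵥ η)).re)
      (m1 := 2 * (cInner η (X *ᵥ φ)).re) (m2 := (cInner η (X *ᵥ η)).re)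
    intro t
    have h1 := key2 (φ + (t : ℂ) • η)
    have e1 : (cInner φ η).re = (cInner η φ).re := ci_re_symm _ _
    have e2 : (cInner φ (X *ᵥ η)).re = (cInner η (X *ᵥ φ)).re := by
      rw [ci_herm hXh, ci_re_symm]
    have e3 : (cInner φ (X₂ *ᵥ η)).re = (cInner η (X₂ *ᵥ φ)).re := by
      rw [ci_herm hX₂h, ci_re_symm]
    have e4 : (cInner (X *ᵥ φ) (X *ᵥ η)).re = (cInner η ((X * X) *ᵥ φ)).re := by
      rw [ci_re_symm, ← ci_herm hXh, Matrix.mulVec_mulVec]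
    have e5 : (cInner (X *ᵥ η) (X *ᵥ φ)).re = (cInner η ((X * X) *ᵥ φ)).re := by
      rw [← ci_herm hXh, Matrix.mulVec_mulVec]
    simp only [Matrix.mulVec_add, Matrix.mulVec_smul, ci_add_left, ci_add_right,
      ci_smul_left, ci_smul_right, Complex.star_def, Complex.conj_ofReal, Complex.re_ofReal_mul,
      Complex.add_re, e1, e2, e3, e4, e5, hfeas₁, hφ, Complex.one_re, ← ha, ← hb] at h1
    convert h1 using 1 <;> ring
  have hbc : cInner φ ((X * X) *ᵥ φ) = (b : ℂ) := by
    rw [hb, ← ci_self_real, ← Matrix.mulVec_mulVec, ci_herm hXh]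
  rw [ci_herm_real hX₂h, ← ha, hbc]
  set η := ((a : ℂ) • (X * X) - (b : ℂ) • X₂) *ᵥ φ with hη
  have h4 := key3 η
  apply ci_self_zero
  have h5 : cInner η η = (a : ℂ) * cInner η ((X * X) *ᵥ φ) - (b : ℂ) * cInner η (X₂ *ᵥ φ) := by
    rw [← ci_smul_right, ← ci_smul_right, ← ci_sub_right, ← Matrix.smul_mulVec,
      ← Matrix.smul_mulVec, ← Matrix.sub_mulVec]
  rw [h5, Complex.sub_re, Complex.re_ofReal_mul, Complex.re_ofReal_mul]
  linarith
end
end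

section
/- Fix integers D ≥ 1, d ≥ 2 and r ≥ 1, a differentiable state family ρ at θ₀ on ℂ^D, and a POVM M on ℂ^d with r outcomes. Then the preprocessing-optimized Fisher information is bounded by the normalized QPFI of the measurement times the quantum Fisher information of the state: F^P(ρ₀, ρ₀', M) ≤ γ(M) · J(ρ₀, ρ₀'). -/
open scoped Matrix Kronecker ComplexOrder
open Classical

noncomputable section

open Matrix in
lemma trace_mul_psd_nonneg {n : Type*} [Fintype n] {k : Type*} [Fintype k] (P : Matrix n k ℂ)
    {T : Matrix n n ℂ} (hT : T.PosSemidef) : 0 ≤ (P * Pᴴ * T).trace := by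
  have h := (hT.conjTranspose_mul_mul_same P).trace_nonneg
  rwa [Matrix.mul_assoc, Matrix.trace_mul_comm, Matrix.mul_assoc, Matrix.trace_mul_comm] at h

lemma psd_sqrt {n : Type*} [Fintype n] {S : Matrix n n ℂ} (hS : S.PosSemidef) :
    ∃ R : Matrix n n ℂ, S = R * Rᴴ := by
  classical
  open scoped MatrixOrder in
  obtain ⟨B, hB⟩ := CStarAlgebra.nonneg_iff_eq_mul_star_self.mp hS.nonneg
  exact ⟨B, hB⟩

lemma trace_psd_mul_psd_nonneg {n : Type*} [Fintype n] {S T : Matrix n n ℂ}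
    (hS : S.PosSemidef) (hT : T.PosSemidef) : 0 ≤ (S * T).trace := by
  obtain ⟨R, rfl⟩ := psd_sqrt hS
  exact trace_mul_psd_nonneg R hT

lemma trace_cs {n k : Type*} [Fintype n] [Fintype k] (P Q : Matrix n k ℂ)
    {T : Matrix n n ℂ} (hT : T.PosSemidef) :
    (Q * Pᴴ * T).trace.re ^ 2 ≤ (Q * Qᴴ * T).trace.re * (P * Pᴴ * T).trace.re := by
  have h : ∀ t : ℝ, 0 ≤ (P * Pᴴ * T).trace.re * (t * t) + 2 * (Q * Pᴴ * T).trace.re * t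
      + (Q * Qᴴ * T).trace.re := by
    intro t
    have h1 := (Complex.nonneg_iff.mp (trace_mul_psd_nonneg (Q + (t : ℂ) • P) hT)).1
    have h2 : (P * Qᴴ * T).trace.re = (Q * Pᴴ * T).trace.re := by
      have : (P * Qᴴ * T).trace = star (Q * Pᴴ * T).trace := by
        rw [← Matrix.trace_conjTranspose]
        simp only [Matrix.conjTranspose_mul, Matrix.conjTranspose_conjTranspose, hT.isHermitian.eq]
        rw [Matrix.trace_mul_comm]
      rw [this]; simp
    have h3 : ((Q + (t : ℂ) • P) * (Q + (t : ℂ) • P)ᴴ * T).trace =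
        (Q * Qᴴ * T).trace + (t : ℂ) * (Q * Pᴴ * T).trace + (t : ℂ) * (P * Qᴴ * T).trace
          + (t : ℂ) * ((t : ℂ) * (P * Pᴴ * T).trace) := by
      simp [Matrix.add_mul, Matrix.mul_add]
      ring
    rw [h3] at h1
    simp only [Complex.add_re, Complex.re_ofReal_mul, h2] at h1
    nlinarith
  have := discrim_le_zero h
  unfold discrim at this
  nlinarith

lemma fisher_eq {n : Type*} [Fintype n] {r : ℕ}
    (ρ ρ' : Matrix n n ℂ) (M : Fin r → Matrix n n ℂ) :
    FisherInfo ρ ρ' M = ∑ i, ((ρ' * M i).trace.re) ^ 2 / ((ρ * M i).trace.re) := by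
  unfold FisherInfo
  refine Finset.sum_congr rfl fun i _ => ?_
  split_ifs with h
  · simp [h]
  · rfl

lemma gamma_eq {n : Type*} [Fintype n] {r : ℕ}
    (M : Fin r → Matrix n n ℂ) (φ φp : n → ℂ) :
    gammaSummand M φ φp =
      ∑ i, ((cInner φ (M i *ᵥ φp)).re) ^ 2 / ((cInner φ (M i *ᵥ φ)).re) := by
  unfold gammaSummand
  refine Finset.sum_congr rfl fun i _ => ?_
  split_ifs with h
  · simp [h]
  · rfl

lemma cInner_trace {n : Type*} [Fintype n] (φ ψ : n → ℂ) (W : Matrix n n ℂ) :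
    cInner φ (W *ᵥ ψ) =
      (Matrix.replicateCol Unit ψ * (Matrix.replicateCol Unit φ)ᴴ * W).trace := by
  simp only [cInner, Matrix.trace, Matrix.diag, Matrix.mul_apply, Matrix.mulVec, dotProduct,
    Matrix.conjTranspose_apply, Matrix.replicateCol_apply, Finset.mul_sum, Finset.univ_unique,
    Finset.sum_singleton]
  rw [Finset.sum_comm]
  refine Finset.sum_congr rfl fun i _ => Finset.sum_congr rfl fun j _ => by ring

lemma cInner_cs {n : Type*} [Fintype n] (φ ψ : n → ℂ) {T : Matrix n n ℂ} (hT : T.PosSemidef) :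
    (cInner φ (T *ᵥ ψ)).re ^ 2 ≤ (cInner ψ (T *ᵥ ψ)).re * (cInner φ (T *ᵥ φ)).re := by
  simp only [cInner_trace]
  exact trace_cs _ _ hT

lemma cInner_nonneg {n : Type*} [Fintype n] (φ : n → ℂ) {T : Matrix n n ℂ} (hT : T.PosSemidef) :
    0 ≤ (cInner φ (T *ᵥ φ)).re := by
  rw [cInner_trace]
  exact (Complex.nonneg_iff.mp (trace_mul_psd_nonneg _ hT)).1

lemma cInner_sum {n : Type*} [Fintype n] {r : ℕ} (φ ψ : n → ℂ) (M : Fin r → Matrix n n ℂ) :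
    cInner φ ((∑ i, M i) *ᵥ ψ) = ∑ i, cInner φ (M i *ᵥ ψ) := by
  simp only [cInner_trace, Finset.mul_sum, Matrix.trace_sum]

lemma div_le_of_cs {a p c : ℝ} (hp : 0 ≤ p) (hc : 0 ≤ c) (h : a ^ 2 ≤ c * p) : a ^ 2 / p ≤ c :=
  div_le_of_le_mul₀ hp hc h

/-- weighted Cauchy-Schwarz for Fisher sums -/
lemma fisher_cs {ι : Type*} [Fintype ι] (x a p : ι → ℝ) (hp : ∀ i, 0 ≤ p i)
    (h0 : ∀ i, p i = 0 → a i = 0) :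
    (∑ i, x i * a i) ^ 2 ≤ (∑ i, x i ^ 2 * p i) * ∑ i, a i ^ 2 / p i := by
  refine Finset.sum_sq_le_sum_mul_sum_of_sq_le_mul _ (fun i _ => ?_) (fun i _ => ?_)
    (fun i _ => ?_)
  · exact mul_nonneg (sq_nonneg _) (hp i)
  · exact div_nonneg (sq_nonneg _) (hp i)
  · by_cases h : p i = 0
    · simp [h, h0 i h]
    · apply le_of_eq; field_simp

lemma gamma_bdd {d r : ℕ} (M : Fin r → Matrix (Fin d) (Fin d) ℂ) (hM : IsPOVM M) :
    BddAbove {x : ℝ | ∃ φ φp : Fin d → ℂ,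
    cInner φ φ = 1 ∧ cInner φp φp = 1 ∧ cInner φ φp = 0 ∧ x = gammaSummand M φ φp} := by
  refine ⟨1, ?_⟩
  rintro x ⟨φ, φp, h1, h2, h3, rfl⟩
  rw [gamma_eq]
  calc _ ≤ ∑ i, (cInner φp (M i *ᵥ φp)).re := Finset.sum_le_sum fun i _ =>
        div_le_of_cs (cInner_nonneg _ (hM.1 i)) (cInner_nonneg _ (hM.1 i)) (cInner_cs _ _ (hM.1 i))
    _ = 1 := by
      rw [← Complex.re_sum, ← cInner_sum, hM.2, Matrix.one_mulVec, h2]; simp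

lemma gamma_nonneg {d r : ℕ} (M : Fin r → Matrix (Fin d) (Fin d) ℂ) (hM : IsPOVM M) :
    0 ≤ gammaPOVM M := by
  apply Real.sSup_nonneg
  rintro x ⟨φ, φp, h1, h2, h3, rfl⟩
  rw [gamma_eq]
  exact Finset.sum_nonneg fun i _ => div_nonneg (sq_nonneg _) (cInner_nonneg _ (hM.1 i))

lemma cInner_smul_smul {n : Type*} [Fintype n] (a b : ℝ) (φ ψ : n → ℂ) :
    cInner ((a : ℂ) • φ) ((b : ℂ) • ψ) = ((a * b : ℝ) : ℂ) * cInner φ ψ := by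
  simp only [cInner, Pi.smul_apply, smul_eq_mul, star_mul', Complex.star_def, Complex.conj_ofReal,
    Finset.mul_sum]
  refine Finset.sum_congr rfl fun i _ => by push_cast; ring

lemma cInner_self {n : Type*} [Fintype n] (φ : n → ℂ) :
    cInner φ φ = ((∑ k, Complex.normSq (φ k) : ℝ) : ℂ) := by
  simp [cInner, Complex.normSq_eq_conj_mul_self]

lemma cInner_herm {n : Type*} [Fintype n] {X : Matrix n n ℂ} (hX : X.IsHermitian) (φ ψ : n → ℂ) :
    cInner φ (X *ᵥ ψ) = cInner (X *ᵥ φ) ψ := by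
  change star φ ⬝ᵥ (X *ᵥ ψ) = star (X *ᵥ φ) ⬝ᵥ ψ
  rw [Matrix.star_mulVec, hX.eq, Matrix.dotProduct_mulVec]

lemma normSq_sum_pos {n : Type*} [Fintype n] {φ : n → ℂ} (h : φ ≠ 0) :
    0 < ∑ k, Complex.normSq (φ k) := by
  obtain ⟨k, hk⟩ := Function.ne_iff.mp h
  exact Finset.sum_pos' (fun _ _ => Complex.normSq_nonneg _)
    ⟨k, Finset.mem_univ _, Complex.normSq_pos.mpr hk⟩

lemma exists_unit {n : Type*} [Fintype n] {φ : n → ℂ} (h : φ ≠ 0) :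
    ∃ s : ℝ, 0 < s ∧ ∃ u : n → ℂ, cInner u u = 1 ∧ φ = (s : ℂ) • u := by
  have hp := normSq_sum_pos h
  set N := ∑ k, Complex.normSq (φ k) with hN
  have hs : 0 < Real.sqrt N := Real.sqrt_pos.mpr hp
  refine ⟨Real.sqrt N, hs, (((Real.sqrt N)⁻¹ : ℝ) : ℂ) • φ, ?_, ?_⟩
  · rw [cInner_smul_smul, cInner_self, ← hN, ← mul_inv, Real.mul_self_sqrt hp.le,
      ← Complex.ofReal_mul, inv_mul_cancel₀ hp.ne', Complex.ofReal_one]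
  · rw [smul_smul, ← Complex.ofReal_mul, mul_inv_cancel₀ hs.ne', Complex.ofReal_one, one_smul]

lemma herm_sum {d r : ℕ} (M : Fin r → Matrix (Fin d) (Fin d) ℂ) (hM : IsPOVM M) (x : Fin r → ℝ) :
    (∑ i, (x i : ℂ) • M i).IsHermitian := by
  unfold Matrix.IsHermitian
  rw [Matrix.conjTranspose_sum]
  refine Finset.sum_congr rfl fun i _ => ?_
  rw [Matrix.conjTranspose_smul, (hM.1 i).isHermitian.eq]; simp

/-- the pure-state inequality with centered observable -/
lemma pure_ineq {d r : ℕ} (M : Fin r → Matrix (Fin d) (Fin d) ℂ) (hM : IsPOVM M) (x : Fin r → ℝ)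
    (v : Fin d → ℂ) (hv : (cInner v ((∑ i, (x i : ℂ) • M i) *ᵥ v)).re = 0) :
    (cInner v (((∑ i, (x i : ℂ) • M i) * (∑ i, (x i : ℂ) • M i)) *ᵥ v)).re ≤
      gammaPOVM M * (cInner v ((∑ i, ((x i ^ 2 : ℝ) : ℂ) • M i) *ᵥ v)).re := by
  have hX := herm_sum M hM x
  set X := ∑ i, (x i : ℂ) • M i with hXdef
  have key : ∀ φ w, cInner φ (X *ᵥ w) = ∑ i, (x i : ℂ) * cInner φ (M i *ᵥ w) := by
    intro φ w
    rw [hXdef, cInner_sum]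
    simp only [cInner_trace, Matrix.mul_smul, Matrix.trace_smul, smul_eq_mul]
  have hX2 : ∀ φ, (cInner φ ((∑ i, ((x i ^ 2 : ℝ) : ℂ) • M i) *ᵥ φ)).re =
      ∑ i, x i ^ 2 * (cInner φ (M i *ᵥ φ)).re := by
    intro φ
    rw [cInner_sum, Complex.re_sum]
    refine Finset.sum_congr rfl fun i _ => ?_
    simp only [cInner_trace, Matrix.mul_smul, Matrix.trace_smul, smul_eq_mul, Complex.re_ofReal_mul]
  have hX2n : 0 ≤ (cInner v ((∑ i, ((x i ^ 2 : ℝ) : ℂ) • M i) *ᵥ v)).re := by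
    rw [hX2]
    exact Finset.sum_nonneg fun i _ => mul_nonneg (sq_nonneg _) (cInner_nonneg _ (hM.1 i))
  rw [← Matrix.mulVec_mulVec, cInner_herm hX]
  by_cases hw : X *ᵥ v = 0
  · rw [hw]
    simpa [cInner] using mul_nonneg (gamma_nonneg M hM) hX2n
  have hv0 : v ≠ 0 := by rintro rfl; simp at hw
  obtain ⟨s, hs, u, hu, hvu⟩ := exists_unit hv0
  obtain ⟨t, ht, y, hy, hwy⟩ := exists_unit hw
  have hvv : cInner v (X *ᵥ v) = 0 := by
    have him : (cInner v (X *ᵥ v)).im = 0 := by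
      have h1 : cInner v (X *ᵥ v) = star (cInner v (X *ᵥ v)) := by
        conv_lhs => rw [cInner_herm hX]
        simp [cInner, mul_comm]
      have := congrArg Complex.im h1
      simp at this
      linarith
    exact Complex.ext hv him
  have huy : cInner u y = 0 := by
    rw [hwy, hvu, cInner_smul_smul] at hvv
    exact (mul_eq_zero.mp hvv).resolve_left (by
      exact_mod_cast (mul_pos hs ht).ne')
  have hg : gammaSummand M u y ≤ gammaPOVM M :=
    le_csSup (gamma_bdd M hM) ⟨u, y, hu, hy, huy, rfl⟩
  rw [gamma_eq] at hg
  have hcs := fisher_cs x (fun i => (cInner u (M i *ᵥ y)).re) (fun i => (cInner u (M i *ᵥ u)).re)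
    (fun i => cInner_nonneg _ (hM.1 i)) (fun i hi => by
      have := cInner_cs u y (hM.1 i)
      rw [hi, mul_zero] at this
      nlinarith)
  have hsum : ∑ i, x i * (cInner u (M i *ᵥ y)).re = (cInner u (X *ᵥ y)).re := by
    rw [key, Complex.re_sum]
    simp only [Complex.re_ofReal_mul]
  have hXu : X *ᵥ u = ((t / s : ℝ) : ℂ) • y := by
    rw [hvu, Matrix.mulVec_smul] at hwy
    have : (s : ℂ) ≠ 0 := by exact_mod_cast hs.ne'
    have h2 := congrArg (fun z => (s : ℂ)⁻¹ • z) hwy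
    simp only [smul_smul, inv_mul_cancel₀ this, one_smul] at h2
    rw [h2]; congr 1; push_cast; field_simp
  have hval : (cInner u (X *ᵥ y)).re = t / s := by
    have := cInner_smul_smul (t / s) 1 y y
    rw [cInner_herm hX, hXu]
    simp only [Complex.ofReal_one, one_smul, mul_one, hy] at this
    rw [this, Complex.ofReal_re]
  rw [hsum, hval, ← hX2 u] at hcs
  have hl : (cInner (X *ᵥ v) (X *ᵥ v)).re = t * t := by
    rw [hwy, cInner_smul_smul, hy]; simp
  have hr : (cInner v ((∑ i, ((x i ^ 2 : ℝ) : ℂ) • M i) *ᵥ v)).re =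
      s * s * (cInner u ((∑ i, ((x i ^ 2 : ℝ) : ℂ) • M i) *ᵥ u)).re := by
    rw [hvu, Matrix.mulVec_smul, cInner_smul_smul, Complex.re_ofReal_mul]
  rw [hl, hr]
  have hAn : 0 ≤ (cInner u ((∑ i, ((x i ^ 2 : ℝ) : ℂ) • M i) *ᵥ u)).re := by
    rw [hX2]
    exact Finset.sum_nonneg fun i _ => mul_nonneg (sq_nonneg _) (cInner_nonneg _ (hM.1 i))
  have h5 := hcs.trans (mul_le_mul_of_nonneg_left hg hAn)
  rw [div_pow, div_le_iff₀ (by positivity)] at h5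
  nlinarith

lemma multiset_sum_nonpos {m : Multiset ℝ} : (∀ y ∈ m, y ≤ 0) → m.sum ≤ 0 := by
  induction m using Multiset.induction_on with
  | empty => simp
  | cons a m ih =>
    intro h
    have h1 := h a (Multiset.mem_cons_self _ _)
    have h2 := ih fun y hy => h y (Multiset.mem_cons_of_mem hy)
    simp only [Multiset.sum_cons]
    linarith

/-- S-lemma (Dines-type averaging) -/
lemma s_lemma {V : Type*} [AddCommGroup V] [Module ℂ V] (q1 q2 : V → ℝ)
    (b1 b2 : V → V → ℝ)
    (h1 : ∀ (c s : ℝ) v w, q1 ((c : ℂ) • v + (s : ℂ) • w) = c ^ 2 * q1 v + c * s * b1 v w + s ^ 2 * q1 w)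
    (h2 : ∀ (c s : ℝ) v w, q2 ((c : ℂ) • v + (s : ℂ) • w) = c ^ 2 * q2 v + c * s * b2 v w + s ^ 2 * q2 w)
    (h : ∀ v, q1 v = 0 → q2 v ≤ 0) :
    ∀ (N : ℕ) (m : Multiset V), m.card = N → (m.map q1).sum = 0 → (m.map q2).sum ≤ 0 := by
  intro N
  induction N with
  | zero =>
    intro m hm _
    rw [Multiset.card_eq_zero.mp hm]; simp
  | succ N ih =>
    intro m hm hsum
    by_cases hall : ∀ v ∈ m, q1 v = 0
    · apply multiset_sum_nonpos
      intro y hy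
      obtain ⟨v, hv, rfl⟩ := Multiset.mem_map.mp hy
      exact h v (hall v hv)
    push Not at hall
    have hpos : ∃ v ∈ m, 0 < q1 v := by
      by_contra! hc
      obtain ⟨v, hv, hne⟩ := hall
      obtain ⟨m', rfl⟩ := Multiset.exists_cons_of_mem hv
      have : ((m'.map q1).sum) ≤ 0 := by
        apply multiset_sum_nonpos
        intro y hy
        obtain ⟨w, hw, rfl⟩ := Multiset.mem_map.mp hy
        exact hc w (Multiset.mem_cons_of_mem hw)
      have h3 := hc v hv
      simp at hsum
      exact hne (by linarith)
    obtain ⟨v, hv, hvp⟩ := hpos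
    obtain ⟨m', rfl⟩ := Multiset.exists_cons_of_mem hv
    have hneg : ∃ w ∈ m', q1 w < 0 := by
      by_contra! hc
      have : 0 ≤ ((m'.map q1).sum) := by
        apply Multiset.sum_nonneg
        intro y hy
        obtain ⟨w, hw, rfl⟩ := Multiset.mem_map.mp hy
        exact hc w hw
      simp at hsum
      linarith
    obtain ⟨w, hw, hwn⟩ := hneg
    obtain ⟨m'', rfl⟩ := Multiset.exists_cons_of_mem hw
    have hcont : Continuous fun t : ℝ => Real.cos t ^ 2 * q1 v + Real.cos t * Real.sin t * b1 v w
        + Real.sin t ^ 2 * q1 w := by fun_prop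
    obtain ⟨t, -, ht⟩ := intermediate_value_Icc' (a := 0) (b := Real.pi / 2) (by positivity)
      hcont.continuousOn (show (0 : ℝ) ∈ _ by simp; constructor <;> linarith)
    simp only at ht
    have hcs := Real.sin_sq_add_cos_sq t
    have e1 := h1 (Real.cos t) (Real.sin t) v w
    have e2 := h2 (Real.cos t) (Real.sin t) v w
    have e3 := h1 (-Real.sin t) (Real.cos t) v w
    have e4 := h2 (-Real.sin t) (Real.cos t) v w
    rw [ht] at e1
    have f1 := h _ e1
    simp only [Multiset.map_cons, Multiset.sum_cons] at hsum ⊢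
    set a := (Real.cos t : ℂ) • v + (Real.sin t : ℂ) • w
    set b := ((-Real.sin t : ℝ) : ℂ) • v + (Real.cos t : ℂ) • w
    have g1 : q1 b = q1 v + q1 w := by
      linear_combination e3 - ht + (q1 v + q1 w) * hcs
    have g2 : q2 b = q2 v + q2 w - q2 a := by
      linear_combination e4 + e2 + (q2 v + q2 w) * hcs
    have := ih (b ::ₘ m'') (by simp at hm ⊢; omega) (by simp; linarith)
    simp at this
    linarith

lemma trace_cols {n : Type*} [Fintype n] (R W : Matrix n n ℂ) :
    (R * Rᴴ * W).trace = ∑ k, cInner (fun i => R i k) (W *ᵥ fun i => R i k) := by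
  simp only [cInner_trace]
  rw [← Matrix.trace_sum, ← Finset.sum_mul]
  congr 2
  ext i j
  simp [Matrix.mul_apply, Matrix.sum_apply]

/-- quadratic-form expansion -/
lemma cInner_quad {n : Type*} [Fintype n] (W : Matrix n n ℂ) (c s : ℝ) (v w : n → ℂ) :
    (cInner ((c : ℂ) • v + (s : ℂ) • w) (W *ᵥ ((c : ℂ) • v + (s : ℂ) • w))).re =
      c ^ 2 * (cInner v (W *ᵥ v)).re +
        c * s * ((cInner v (W *ᵥ w)).re + (cInner w (W *ᵥ v)).re) +
        s ^ 2 * (cInner w (W *ᵥ w)).re := by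
  have : cInner ((c : ℂ) • v + (s : ℂ) • w) (W *ᵥ ((c : ℂ) • v + (s : ℂ) • w)) =
      ((c ^ 2 : ℝ) : ℂ) * cInner v (W *ᵥ v) + ((c * s : ℝ) : ℂ) * cInner v (W *ᵥ w)
      + ((c * s : ℝ) : ℂ) * cInner w (W *ᵥ v) + ((s ^ 2 : ℝ) : ℂ) * cInner w (W *ᵥ w) := by
    rw [Matrix.mulVec_add, Matrix.mulVec_smul, Matrix.mulVec_smul]
    simp only [cInner, Finset.mul_sum, ← Finset.sum_add_distrib]
    refine Finset.sum_congr rfl fun i _ => ?_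
    simp only [Pi.add_apply, Pi.smul_apply, smul_eq_mul, star_add, star_mul', Complex.star_def,
      Complex.conj_ofReal]
    push_cast
    ring
  rw [this]
  simp only [Complex.add_re, Complex.re_ofReal_mul]
  ring

lemma mixed_ineq {d r : ℕ} (M : Fin r → Matrix (Fin d) (Fin d) ℂ) (hM : IsPOVM M) (x : Fin r → ℝ)
    {σ : Matrix (Fin d) (Fin d) ℂ} (hσ : σ.PosSemidef)
    (h0 : (σ * ∑ i, (x i : ℂ) • M i).trace.re = 0) :
    (σ * ((∑ i, (x i : ℂ) • M i) * (∑ i, (x i : ℂ) • M i))).trace.re ≤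
      gammaPOVM M * (σ * ∑ i, ((x i ^ 2 : ℝ) : ℂ) • M i).trace.re := by
  obtain ⟨R, rfl⟩ := psd_sqrt hσ
  have hp := pure_ineq M hM x
  set X := ∑ i, (x i : ℂ) • M i
  set X2 := ∑ i, ((x i ^ 2 : ℝ) : ℂ) • M i
  set g := gammaPOVM M
  have := s_lemma (V := Fin d → ℂ) (fun v => (cInner v (X *ᵥ v)).re)
    (fun v => (cInner v ((X * X) *ᵥ v)).re - g * (cInner v (X2 *ᵥ v)).re)
    (fun v w => (cInner v (X *ᵥ w)).re + (cInner w (X *ᵥ v)).re)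
    (fun v w => ((cInner v ((X * X) *ᵥ w)).re + (cInner w ((X * X) *ᵥ v)).re)
      - g * ((cInner v (X2 *ᵥ w)).re + (cInner w (X2 *ᵥ v)).re))
    (fun c s v w => cInner_quad X c s v w)
    (fun c s v w => by
      rw [cInner_quad (X * X), cInner_quad X2]; ring)
    (fun v hv => by
      have := hp v hv
      linarith)
    _ ((Finset.univ : Finset (Fin d)).val.map (fun k => fun i => R i k)) rfl (by
      rw [trace_cols, Complex.re_sum] at h0
      rw [Multiset.map_map]
      exact h0)
  rw [Multiset.map_map] at this
  change ∑ k, ((cInner (fun i => R i k) ((X * X) *ᵥ fun i => R i k)).re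
    - g * (cInner (fun i => R i k) (X2 *ᵥ fun i => R i k)).re) ≤ 0 at this
  rw [Finset.sum_sub_distrib, ← Finset.mul_sum, ← Complex.re_sum, ← Complex.re_sum,
    ← trace_cols, ← trace_cols] at this
  linarith

section family

variable {D : ℕ} {ρ : ℝ → Matrix (Fin D) (Fin D) ℂ} {ρ' : Matrix (Fin D) (Fin D) ℂ} {θ₀ : ℝ}

lemma der_trace (hder : ∀ i j, HasDerivAt (fun θ => ρ θ i j) (ρ' i j) θ₀)
    (T : Matrix (Fin D) (Fin D) ℂ) :
    HasDerivAt (fun θ => (ρ θ * T).trace.re) (ρ' * T).trace.re θ₀ := by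
  have h : HasDerivAt (fun θ => (ρ θ * T).trace) (ρ' * T).trace θ₀ := by
    simp only [Matrix.trace, Matrix.diag, Matrix.mul_apply]
    exact HasDerivAt.fun_sum fun i _ => HasDerivAt.fun_sum fun j _ => (hder i j).mul_const _
  exact (Complex.reCLM.hasFDerivAt.comp_hasDerivAt θ₀ h)

lemma der_zero (hdens : ∀ θ, IsDensityMatrix (ρ θ))
    (hder : ∀ i j, HasDerivAt (fun θ => ρ θ i j) (ρ' i j) θ₀)
    {T : Matrix (Fin D) (Fin D) ℂ} (hT : T.PosSemidef) (h0 : (ρ θ₀ * T).trace.re = 0) :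
    (ρ' * T).trace.re = 0 := by
  refine IsLocalMin.hasDerivAt_eq_zero ?_ (der_trace hder T)
  refine Filter.Eventually.of_forall fun θ => ?_
  simp only [h0]
  exact (Complex.nonneg_iff.mp (trace_psd_mul_psd_nonneg (hdens θ).1 hT)).1

lemma der_trace_zero (hdens : ∀ θ, IsDensityMatrix (ρ θ))
    (hder : ∀ i j, HasDerivAt (fun θ => ρ θ i j) (ρ' i j) θ₀) : ρ'.trace.re = 0 := by
  have h := der_trace hder 1
  simp only [mul_one, (hdens _).2] at h
  exact h.unique (hasDerivAt_const _ _)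

lemma der_herm (hdens : ∀ θ, IsDensityMatrix (ρ θ))
    (hder : ∀ i j, HasDerivAt (fun θ => ρ θ i j) (ρ' i j) θ₀) : ρ'.IsHermitian := by
  ext i j
  have h1 := (hder j i).star
  have h2 : (fun θ => star (ρ θ j i)) = fun θ => ρ θ i j := by
    funext θ
    exact (hdens θ).1.isHermitian.apply i j
  rw [h2] at h1
  exact h1.unique (hder i j)

lemma exists_sld (hdens : ∀ θ, IsDensityMatrix (ρ θ))
    (hder : ∀ i j, HasDerivAt (fun θ => ρ θ i j) (ρ' i j) θ₀) :
    ∃ A : Matrix (Fin D) (Fin D) ℂ, ρ' = A * ρ θ₀ + ρ θ₀ * Aᴴ := by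
  have hH := (hdens θ₀).1.isHermitian
  have hnn := (hdens θ₀).1.eigenvalues_nonneg
  have hsp := hH.spectral_theorem
  rw [Unitary.conjStarAlgAut_apply] at hsp
  set U : Matrix (Fin D) (Fin D) ℂ := hH.eigenvectorUnitary.1 with hU
  set l := hH.eigenvalues with hl
  have hUU : Uᴴ * U = 1 := Unitary.coe_star_mul_self hH.eigenvectorUnitary
  have hUU' : U * Uᴴ = 1 := Unitary.coe_mul_star_self hH.eigenvectorUnitary
  set L : Matrix (Fin D) (Fin D) ℂ := Matrix.diagonal (RCLike.ofReal ∘ l) with hL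
  change ρ θ₀ = U * L * Uᴴ at hsp
  set B := Uᴴ * ρ' * U with hB
  have hBh : B.IsHermitian := Matrix.isHermitian_conjTranspose_mul_mul U (der_herm hdens hder)
  -- derivative vanishes on the kernel block
  have hq : ∀ z : Fin D → ℂ, cInner z (L *ᵥ z) = 0 → (cInner z (B *ᵥ z)).re = 0 := by
    intro z hz
    have hc : ∀ S : Matrix (Fin D) (Fin D) ℂ, cInner z ((Uᴴ * S * U) *ᵥ z) =
        (S * ((U * Matrix.replicateCol Unit z) * (U * Matrix.replicateCol Unit z)ᴴ)).trace := by
      intro S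
      rw [cInner_trace, Matrix.conjTranspose_mul, Matrix.trace_mul_comm, Matrix.mul_assoc,
        Matrix.mul_assoc, Matrix.trace_mul_comm]
      simp only [Matrix.mul_assoc]
    rw [hB, hc]
    apply der_zero hdens hder (Matrix.posSemidef_self_mul_conjTranspose _)
    rw [← hc, hsp]
    have : Uᴴ * (U * L * Uᴴ) * U = L := by
      calc _ = (Uᴴ * U) * L * (Uᴴ * U) := by simp only [Matrix.mul_assoc]
        _ = L := by rw [hUU]; simp
    rw [this, hz]; rfl
  have hk : ∀ k m, l k = 0 → l m = 0 → B k m = 0 := by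
    intro k m h1 h2
    have hLk : ∀ i, l i = 0 → L *ᵥ (Pi.single i 1) = 0 := by
      intro i hi
      rw [hL, Matrix.mulVec_single_one]
      ext j
      simp [Matrix.diagonal, Matrix.col_apply]
      rintro rfl; exact_mod_cast hi
    have hv : ∀ a : ℂ, (cInner (Pi.single k 1 + a • Pi.single m 1)
        (B *ᵥ (Pi.single k 1 + a • Pi.single m 1))).re = 0 := fun a => hq _ (by
          rw [Matrix.mulVec_add, Matrix.mulVec_smul, hLk k h1, hLk m h2]; simp [cInner])
    have hx : ∀ (a : ℂ), cInner (Pi.single k 1 + a • Pi.single m 1)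
        (B *ᵥ (Pi.single k 1 + a • Pi.single m 1)) =
        B k k + a * B k m + star a * B m k + star a * a * B m m := by
      intro a
      change star _ ⬝ᵥ _ = _
      simp only [Matrix.mulVec_add, Matrix.mulVec_smul, Matrix.mulVec_single_one, star_add,
        star_smul, add_dotProduct, dotProduct_add, smul_dotProduct, dotProduct_smul, smul_eq_mul,
        ← Pi.single_star, star_one, single_one_dotProduct, Matrix.col_apply]
      ring
    have hkk := hv 0
    rw [hx] at hkk
    have hmm : (B m m).re = 0 := by
      have := hq (Pi.single m 1) (by rw [hLk m h2]; simp [cInner])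
      change (star _ ⬝ᵥ _ : ℂ).re = 0 at this
      simpa only [Matrix.mulVec_single_one, ← Pi.single_star, star_one, single_one_dotProduct,
        Matrix.col_apply] using this
    have hmi : (B m m).im = 0 := by
      have := congrArg Complex.im (hBh.apply m m)
      simp at this; linarith
    have hkm := hv (star (B k m))
    rw [hx, hBh.apply m k |>.symm] at hkm
    simp [hmm, hmi] at hkk hkm
    rw [hkk] at hkm
    apply Complex.ext <;> simp <;> nlinarith [sq_nonneg (B k m).re, sq_nonneg (B k m).im]
  set C : Matrix (Fin D) (Fin D) ℂ := fun k m => B k m / ((l k + l m : ℝ) : ℂ) with hC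
  have hCB : B = C * L + L * Cᴴ := by
    ext k m
    rw [hL, Matrix.add_apply, Matrix.mul_diagonal, Matrix.diagonal_mul, Matrix.conjTranspose_apply]
    simp only [hC, star_div₀, hBh.apply k m, Complex.star_def, Complex.conj_ofReal,
      Function.comp]
    by_cases h : l k + l m = 0
    · rw [hk k m (by linarith [hnn k, hnn m]) (by linarith [hnn k, hnn m])]
      simp
    · have h2 : ((l k : ℂ) + l m) ≠ 0 := by exact_mod_cast h
      rw [add_comm (l m)]
      push_cast
      field_simp
      simp
      left
      ring
  refine ⟨U * C * Uᴴ, ?_⟩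
  calc ρ' = (U * Uᴴ) * ρ' * (U * Uᴴ) := by rw [hUU']; simp
    _ = U * B * Uᴴ := by rw [hB]; simp only [Matrix.mul_assoc]
    _ = U * C * 1 * L * Uᴴ + U * L * 1 * Cᴴ * Uᴴ := by
      rw [hCB]; simp [Matrix.mul_add, Matrix.add_mul, Matrix.mul_assoc]
    _ = _ := by
      rw [hsp, ← hUU]
      simp only [Matrix.conjTranspose_mul, Matrix.conjTranspose_conjTranspose, Matrix.mul_assoc]

lemma qfi_bdd (hdens : ∀ θ, IsDensityMatrix (ρ θ))
    (hder : ∀ i j, HasDerivAt (fun θ => ρ θ i j) (ρ' i j) θ₀) :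
    BddAbove {x : ℝ | ∃ (κ : ℕ) (T : Fin κ → Matrix (Fin D) (Fin D) ℂ),
      IsPOVM T ∧ x = FisherInfo (ρ θ₀) ρ' T} := by
  obtain ⟨A, hA⟩ := exists_sld hdens hder
  obtain ⟨R, hR⟩ := psd_sqrt (hdens θ₀).1
  refine ⟨4 * ((A * R) * (A * R)ᴴ).trace.re, ?_⟩
  rintro x ⟨κ, T, hT, rfl⟩
  rw [fisher_eq]
  calc _ ≤ ∑ i, 4 * ((A * R) * (A * R)ᴴ * T i).trace.re := Finset.sum_le_sum fun i _ => by
        have h1 := trace_cs R (A * R) (hT.1 i)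
        have h2 : (ρ' * T i).trace.re = 2 * (A * R * Rᴴ * T i).trace.re := by
          have : (R * (A * R)ᴴ * T i).trace = star (A * R * Rᴴ * T i).trace := by
            rw [← Matrix.trace_conjTranspose]
            simp only [Matrix.conjTranspose_mul, Matrix.conjTranspose_conjTranspose,
              (hT.1 i).isHermitian.eq]
            rw [Matrix.trace_mul_comm]
          rw [hA, hR, Matrix.add_mul, Matrix.trace_add, Complex.add_re]
          rw [Matrix.conjTranspose_mul] at this
          simp only [Matrix.mul_assoc] at this ⊢
          rw [this]; simp; ring
        have hp := (Complex.nonneg_iff.mp (trace_mul_psd_nonneg R (hT.1 i))).1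
        have hc := (Complex.nonneg_iff.mp (trace_mul_psd_nonneg (A * R) (hT.1 i))).1
        rw [h2, hR]
        refine div_le_of_cs hp (by linarith) ?_
        nlinarith
    _ = _ := by
      rw [← Finset.mul_sum, ← Complex.re_sum, ← Matrix.trace_sum, ← Finset.mul_sum, hT.2, mul_one]

lemma qfi_nonneg (hdens : ∀ θ, IsDensityMatrix (ρ θ)) : 0 ≤ QFI (ρ θ₀) ρ' := by
  apply Real.sSup_nonneg
  rintro x ⟨κ, T, hT, rfl⟩
  rw [fisher_eq]
  exact Finset.sum_nonneg fun i _ => div_nonneg (sq_nonneg _)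
    (Complex.nonneg_iff.mp (trace_psd_mul_psd_nonneg (hdens _).1 (hT.1 i))).1

lemma qfi_cs (hdens : ∀ θ, IsDensityMatrix (ρ θ))
    (hder : ∀ i j, HasDerivAt (fun θ => ρ θ i j) (ρ' i j) θ₀)
    {Y : Matrix (Fin D) (Fin D) ℂ} (hY : Y.IsHermitian) :
    (ρ' * Y).trace.re ^ 2 ≤ (ρ θ₀ * (Y * Y)).trace.re * QFI (ρ θ₀) ρ' := by
  have hsp := hY.spectral_theorem
  rw [Unitary.conjStarAlgAut_apply] at hsp
  set U : Matrix (Fin D) (Fin D) ℂ := hY.eigenvectorUnitary.1 with hU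
  set l := hY.eigenvalues with hl
  have hUU : Uᴴ * U = 1 := Unitary.coe_star_mul_self hY.eigenvectorUnitary
  have hUU' : U * Uᴴ = 1 := Unitary.coe_mul_star_self hY.eigenvectorUnitary
  change Y = U * _ * Uᴴ at hsp
  let T : Fin D → Matrix (Fin D) (Fin D) ℂ := fun k => U * Matrix.single k k 1 * Uᴴ
  have hsum : ∀ f : Fin D → ℂ, ∑ k, f k • T k = U * Matrix.diagonal f * Uᴴ := by
    intro f
    rw [← Matrix.sum_single_eq_diagonal, Finset.mul_sum, Finset.sum_mul]
    refine Finset.sum_congr rfl fun k _ => ?_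
    simp only [T]
    rw [← Matrix.smul_mul, ← Matrix.mul_smul, Matrix.smul_single]
    simp
  have hT : IsPOVM T := by
    constructor
    · intro k
      refine Matrix.PosSemidef.mul_mul_conjTranspose_same ?_ U
      rw [← Matrix.diagonal_single]
      exact Matrix.PosSemidef.diagonal (by
        rw [Pi.single_nonneg]; exact zero_le_one)
    · have := hsum 1
      simpa [hUU'] using this
  have hY1 : Y = ∑ k, (l k : ℂ) • T k := by rw [hsum]; exact hsp
  have hY2 : Y * Y = ∑ k, ((l k ^ 2 : ℝ) : ℂ) • T k := by
    rw [hsum]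
    nth_rw 1 [hsp]
    nth_rw 1 [hsp]
    calc _ = U * Matrix.diagonal (RCLike.ofReal ∘ l) * (Uᴴ * U) *
          Matrix.diagonal (RCLike.ofReal ∘ l) * Uᴴ := by simp only [Matrix.mul_assoc]
      _ = _ := by
        rw [hUU, mul_one, Matrix.mul_assoc U, Matrix.diagonal_mul_diagonal]
        congr 3
        funext k
        simp [sq]
  have htr : ∀ (S : Matrix (Fin D) (Fin D) ℂ) (f : Fin D → ℝ),
      (S * ∑ k, (f k : ℂ) • T k).trace.re = ∑ k, f k * (S * T k).trace.re := by
    intro S f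
    rw [Finset.mul_sum, Matrix.trace_sum, Complex.re_sum]
    refine Finset.sum_congr rfl fun k _ => ?_
    rw [Matrix.mul_smul, Matrix.trace_smul, smul_eq_mul, Complex.re_ofReal_mul]
  have hnn : ∀ k, 0 ≤ (ρ θ₀ * T k).trace.re := fun k =>
    (Complex.nonneg_iff.mp (trace_psd_mul_psd_nonneg (hdens _).1 (hT.1 k))).1
  have hcs := fisher_cs l (fun k => (ρ' * T k).trace.re) (fun k => (ρ θ₀ * T k).trace.re) hnn
    (fun k hk => der_zero hdens hder (hT.1 k) hk)
  have hJ : FisherInfo (ρ θ₀) ρ' T ≤ QFI (ρ θ₀) ρ' :=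
    le_csSup (qfi_bdd hdens hder) ⟨D, T, hT, rfl⟩
  rw [fisher_eq] at hJ
  rw [hY2, htr]
  rw [← htr, ← hY1] at hcs
  exact hcs.trans (mul_le_mul_of_nonneg_left hJ
    (Finset.sum_nonneg fun k _ => mul_nonneg (sq_nonneg _) (hnn k)))

/-- the dual (Heisenberg) map -/
lemma channel_trace {d κ : ℕ} (K : Fin κ → Matrix (Fin d) (Fin D) ℂ)
    (σ : Matrix (Fin D) (Fin D) ℂ) (X : Matrix (Fin d) (Fin d) ℂ) :
    ((∑ j, K j * σ * (K j)ᴴ) * X).trace = (σ * ∑ j, (K j)ᴴ * X * K j).trace := by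
  rw [Finset.sum_mul, Finset.mul_sum, Matrix.trace_sum, Matrix.trace_sum]
  refine Finset.sum_congr rfl fun j _ => ?_
  rw [Matrix.mul_assoc, Matrix.mul_assoc, Matrix.trace_mul_comm]
  simp only [Matrix.mul_assoc]

lemma kadison {d κ : ℕ} (K : Fin κ → Matrix (Fin d) (Fin D) ℂ)
    (hK : ∑ j, (K j)ᴴ * K j = 1)
    {σ : Matrix (Fin D) (Fin D) ℂ} (hσ : σ.PosSemidef) {X : Matrix (Fin d) (Fin d) ℂ}
    (hX : X.IsHermitian) (Y : Matrix (Fin D) (Fin D) ℂ) (hYdef : Y = ∑ j, (K j)ᴴ * X * K j)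
    (hY : Y.IsHermitian) :
    (σ * (Y * Y)).trace.re ≤ (σ * ∑ j, (K j)ᴴ * (X * X) * K j).trace.re := by
  have h1 : ∑ j, (X * K j - K j * Y)ᴴ * (X * K j - K j * Y) =
      ∑ j, (K j)ᴴ * (X * X) * K j - Y * Y := by
    have : ∀ j, (X * K j - K j * Y)ᴴ * (X * K j - K j * Y) = (K j)ᴴ * (X * X) * K j
        - (K j)ᴴ * X * K j * Y - Y * ((K j)ᴴ * X * K j) + Y * ((K j)ᴴ * K j) * Y := by
      intro j
      simp only [Matrix.conjTranspose_sub, Matrix.conjTranspose_mul, hX.eq, hY.eq, Matrix.sub_mul,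
        Matrix.mul_sub, Matrix.mul_assoc]
      abel
    simp only [this, Finset.sum_add_distrib, Finset.sum_sub_distrib, ← Finset.sum_mul,
      ← Finset.mul_sum, hK, ← hYdef]
    simp
  have h2 : (∑ j, (X * K j - K j * Y)ᴴ * (X * K j - K j * Y)).PosSemidef :=
    Matrix.posSemidef_sum _ fun j _ => Matrix.posSemidef_conjTranspose_mul_self _
  rw [h1] at h2
  have h3 := (Complex.nonneg_iff.mp (trace_psd_mul_psd_nonneg hσ h2)).1
  rw [Matrix.mul_sub, Matrix.trace_sub, Complex.sub_re] at h3
  linarith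

end family

/-- for any state family and any POVM, the preprocessing-optimized Fisher
information is bounded by the normalized QPFI of the measurement times the quantum Fisher
information of the state. -/
theorem stmt17 {D d r : ℕ} (hD : 1 ≤ D) (hd : 2 ≤ d) (hr : 1 ≤ r)
    (ρ : ℝ → Matrix (Fin D) (Fin D) ℂ) (ρ' : Matrix (Fin D) (Fin D) ℂ) (θ₀ : ℝ)
    (hdens : ∀ θ, IsDensityMatrix (ρ θ))
    (hder : ∀ i j, HasDerivAt (fun θ => ρ θ i j) (ρ' i j) θ₀)
    (M : Fin r → Matrix (Fin d) (Fin d) ℂ) (hM : IsPOVM M) :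
    QPFI (ρ θ₀) ρ' M ≤ gammaPOVM M * QFI (ρ θ₀) ρ' := by
  apply Real.sSup_le
  · rintro _ ⟨E, ⟨κ, K, hK, hE⟩, rfl⟩
    have hγ := gamma_nonneg M hM
    have hJ : 0 ≤ QFI (ρ θ₀) ρ' := qfi_nonneg hdens
    rw [fisher_eq]
    have hEP : (E (ρ θ₀)).PosSemidef := by
      rw [hE]
      exact Matrix.posSemidef_sum _ fun j _ => (hdens θ₀).1.mul_mul_conjTranspose_same (K j)
    have hp : ∀ i, 0 ≤ (E (ρ θ₀) * M i).trace.re := fun i =>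
      (Complex.nonneg_iff.mp (trace_psd_mul_psd_nonneg hEP (hM.1 i))).1
    have ha : ∀ i, (E (ρ θ₀) * M i).trace.re = 0 → (E ρ' * M i).trace.re = 0 := by
      intro i hi
      rw [hE, channel_trace] at hi ⊢
      exact der_zero hdens hder (Matrix.posSemidef_sum _ fun j _ =>
        (hM.1 i).conjTranspose_mul_mul_same (K j)) hi
    let x : Fin r → ℝ := fun i => (E ρ' * M i).trace.re / (E (ρ θ₀) * M i).trace.re
    have htr : ∀ (S : Matrix (Fin d) (Fin d) ℂ) (f : Fin r → ℝ),
        (S * ∑ k, (f k : ℂ) • M k).trace.re = ∑ k, f k * (S * M k).trace.re := by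
      intro S f
      rw [Finset.mul_sum, Matrix.trace_sum, Complex.re_sum]
      refine Finset.sum_congr rfl fun k _ => ?_
      rw [Matrix.mul_smul, Matrix.trace_smul, smul_eq_mul, Complex.re_ofReal_mul]
    have hX := herm_sum M hM x
    have e0 : (E (ρ θ₀) * ∑ i, (x i : ℂ) • M i).trace.re = 0 := by
      rw [htr]
      calc _ = ∑ i, (E ρ' * M i).trace.re := Finset.sum_congr rfl fun i _ => by
            by_cases h : (E (ρ θ₀) * M i).trace.re = 0
            · rw [h, ha i h]; simp
            · exact div_mul_cancel₀ _ h
        _ = 0 := by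
          rw [← Complex.re_sum, ← Matrix.trace_sum, ← Finset.mul_sum, hM.2, hE, channel_trace]
          simp only [Matrix.mul_one, hK]
          exact der_trace_zero hdens hder
    have e1 : (E ρ' * ∑ i, (x i : ℂ) • M i).trace.re =
        ∑ i, (E ρ' * M i).trace.re ^ 2 / (E (ρ θ₀) * M i).trace.re := by
      rw [htr]
      refine Finset.sum_congr rfl fun i _ => ?_
      simp only [x]; ring
    have e2 : (E (ρ θ₀) * ∑ i, ((x i ^ 2 : ℝ) : ℂ) • M i).trace.re =
        ∑ i, (E ρ' * M i).trace.re ^ 2 / (E (ρ θ₀) * M i).trace.re := by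
      rw [htr]
      refine Finset.sum_congr rfl fun i _ => ?_
      simp only [x]
      by_cases h : (E (ρ θ₀) * M i).trace.re = 0
      · rw [h]; simp
      · field_simp
    have hmix := mixed_ineq M hM x hEP e0
    rw [e2] at hmix
    have hF : 0 ≤ ∑ i, (E ρ' * M i).trace.re ^ 2 / (E (ρ θ₀) * M i).trace.re :=
      Finset.sum_nonneg fun i _ => div_nonneg (sq_nonneg _) (hp i)
    set F := ∑ i, (E ρ' * M i).trace.re ^ 2 / (E (ρ θ₀) * M i).trace.re
    set X := ∑ i, (x i : ℂ) • M i
    have hY : (∑ j, (K j)ᴴ * X * K j).IsHermitian := by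
      unfold Matrix.IsHermitian
      rw [Matrix.conjTranspose_sum]
      exact Finset.sum_congr rfl fun j _ => Matrix.isHermitian_conjTranspose_mul_mul (K j) hX
    have hk := kadison K hK (hdens θ₀).1 hX _ rfl hY
    have hq := qfi_cs hdens hder hY
    rw [← channel_trace, ← hE, e1] at hq
    rw [← channel_trace, ← hE] at hk
    have h1 : F ^ 2 ≤ gammaPOVM M * F * QFI (ρ θ₀) ρ' :=
      hq.trans (mul_le_mul_of_nonneg_right (hk.trans hmix) hJ)
    rcases hF.eq_or_lt with h | h
    · rw [← h]; exact mul_nonneg hγ hJ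
    · nlinarith
  · exact mul_nonneg (gamma_nonneg M hM) (qfi_nonneg hdens)
end
end
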